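/- arXiv:2402.02305 — 2 statements merged into one kernel-verified Lean document; each statement's English description precedes it below -/
import Mathlib

section
/- Let S = k[x_1,…,x_r], λ an extra variable, and J_λ = (x_1, λ(x_2-x_3)+x_3)·(x_3,…,x_{i+4}) ⊆ S[λ] with 4+i ≤ r. Then S[λ]/J_λ is a flat (equivalently, torsion-free) k[λ]-module. -/
open Polynomial MvPolynomial

namespace SundialAux

/-- The endomorphism of `S[λ]` killing the variables in `T`. -/
noncomputable def kill {k : Type*} [Field k] {r : ℕ} (T : Set (Fin r)) :
    Polynomial (MvPolynomial (Fin r) k) →+* Polynomial (MvPolynomial (Fin r) k) :=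
  open Classical in
  Polynomial.mapRingHom
    (MvPolynomial.aeval (R := k)
      (fun j => if j ∈ T then (0 : MvPolynomial (Fin r) k) else MvPolynomial.X j)).toRingHom

/-- The ideal generated by the variables in `T`. -/
noncomputable def idl (k : Type*) [Field k] {r : ℕ} (T : Set (Fin r)) :
    Ideal (Polynomial (MvPolynomial (Fin r) k)) :=
  Ideal.span ((fun j => Polynomial.C (MvPolynomial.X j : MvPolynomial (Fin r) k)) '' T)

variable {k : Type*} [Field k] {r : ℕ} (T : Set (Fin r))

lemma kill_X_mem {j : Fin r} (h : j ∈ T) :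
    kill T (Polynomial.C (MvPolynomial.X j : MvPolynomial (Fin r) k)) = 0 := by
  simp [kill, h]

lemma kill_X_not_mem {j : Fin r} (h : j ∉ T) :
    kill T (Polynomial.C (MvPolynomial.X j : MvPolynomial (Fin r) k)) =
      Polynomial.C (MvPolynomial.X j) := by
  simp [kill, h]

lemma kill_lam :
    kill T (Polynomial.X : Polynomial (MvPolynomial (Fin r) k)) = Polynomial.X := by
  simp [kill]

lemma kill_base (p : Polynomial k) :
    kill T (Polynomial.mapRingHom (MvPolynomial.C : k →+* MvPolynomial (Fin r) k) p) =
      Polynomial.mapRingHom (MvPolynomial.C : k →+* MvPolynomial (Fin r) k) p := by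
  simp only [kill, Polynomial.coe_mapRingHom, Polynomial.map_map]
  congr 1
  ext a : 1
  simp

lemma sub_kill_mem (f : Polynomial (MvPolynomial (Fin r) k)) : f - kill T f ∈ idl k T := by
  have h : (Ideal.Quotient.mk (idl k T)).comp (kill T) = Ideal.Quotient.mk (idl k T) := by
    refine Polynomial.ringHom_ext' ?_ ?_
    · refine MvPolynomial.ringHom_ext ?_ ?_
      · intro a
        simp [kill]
      · intro j
        by_cases hj : j ∈ T
        · simp only [RingHom.comp_apply, kill_X_mem T hj, map_zero]
          symm
          rw [Ideal.Quotient.eq_zero_iff_mem]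
          exact Ideal.subset_span ⟨j, hj, rfl⟩
        · simp only [RingHom.comp_apply, kill_X_not_mem T hj]
    · simp only [RingHom.comp_apply, kill_lam]
  rw [← Ideal.Quotient.eq]
  exact (congrArg (fun g => g f) h).symm

lemma mem_idl_iff (f : Polynomial (MvPolynomial (Fin r) k)) :
    f ∈ idl k T ↔ kill T f = 0 := by
  constructor
  · intro hf
    have : idl k T ≤ RingHom.ker (kill T) := by
      refine Ideal.span_le.2 ?_
      rintro _ ⟨j, hj, rfl⟩
      exact kill_X_mem T hj
    exact this hf
  · intro h
    have := sub_kill_mem T f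
    rwa [h, sub_zero] at this

lemma base_ne_zero {p : Polynomial k} (hp : p ≠ 0) :
    Polynomial.mapRingHom (MvPolynomial.C : k →+* MvPolynomial (Fin r) k) p ≠ 0 := by
  rw [Polynomial.coe_mapRingHom]
  exact (Polynomial.map_ne_zero_iff (MvPolynomial.C_injective _ _)).2 hp

lemma idl_base {p : Polynomial k} (hp : p ≠ 0) {f : Polynomial (MvPolynomial (Fin r) k)}
    (h : Polynomial.mapRingHom (MvPolynomial.C : k →+* MvPolynomial (Fin r) k) p * f ∈ idl k T) :
    f ∈ idl k T := by
  rw [mem_idl_iff] at h ⊢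
  rw [map_mul, kill_base] at h
  exact (mul_eq_zero.1 h).resolve_left (base_ne_zero hp)

lemma ell_prime {a b : Fin r} (hab : a ≠ b) :
    Prime (Polynomial.X * Polynomial.C (MvPolynomial.X a - MvPolynomial.X b) +
          Polynomial.C (MvPolynomial.X b) : Polynomial (MvPolynomial (Fin r) k)) := by
  have hne : (MvPolynomial.X a - MvPolynomial.X b : MvPolynomial (Fin r) k) ≠ 0 := by
    rw [sub_ne_zero]
    exact fun h => hab (MvPolynomial.X_injective h)
  rw [← UniqueFactorizationMonoid.irreducible_iff_prime, mul_comm]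
  apply Polynomial.irreducible_C_mul_X_add_C hne
  refine IsRelPrime.symm ?_
  refine (MvPolynomial.X_prime.irreducible.isRelPrime_iff_not_dvd).2 ?_
  intro h
  have := (dvd_sub_left (dvd_refl _)).1 h
  rw [MvPolynomial.X_dvd_X] at this
  exact hab this.symm

lemma key (z a b : Fin r) (hza : z ≠ a) (hzb : z ≠ b) (hab : a ≠ b) (hzT : z ∉ T)
    {p : Polynomial k} (hp : p ≠ 0) {f : Polynomial (MvPolynomial (Fin r) k)}
    (h : Polynomial.mapRingHom (MvPolynomial.C : k →+* MvPolynomial (Fin r) k) p * f ∈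
      Ideal.span {Polynomial.C (MvPolynomial.X z : MvPolynomial (Fin r) k),
        Polynomial.X * Polynomial.C (MvPolynomial.X a - MvPolynomial.X b) +
          Polynomial.C (MvPolynomial.X b)} * idl k T) :
    f ∈ Ideal.span {Polynomial.C (MvPolynomial.X z : MvPolynomial (Fin r) k),
        Polynomial.X * Polynomial.C (MvPolynomial.X a - MvPolynomial.X b) +
          Polynomial.C (MvPolynomial.X b)} * idl k T := by
  have hpf := Ideal.mul_le_right h
  have hfQ : f ∈ idl k T := idl_base T hp hpf
  clear hpf
  have hl := ell_prime (k := k) hab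
  have hl1 : kill {z} (Polynomial.X * Polynomial.C (MvPolynomial.X a - MvPolynomial.X b) +
          Polynomial.C (MvPolynomial.X b) : Polynomial (MvPolynomial (Fin r) k)) =
          Polynomial.X * Polynomial.C (MvPolynomial.X a - MvPolynomial.X b) +
          Polynomial.C (MvPolynomial.X b) := by
    rw [map_add, map_mul, Polynomial.C_sub, map_sub, kill_lam,
      kill_X_not_mem _ (by simpa using hza.symm), kill_X_not_mem _ (by simpa using hzb.symm)]
  have hl2 : kill {a, b} (Polynomial.X * Polynomial.C (MvPolynomial.X a - MvPolynomial.X b) +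
          Polynomial.C (MvPolynomial.X b) : Polynomial (MvPolynomial (Fin r) k)) = 0 := by
    rw [map_add, map_mul, Polynomial.C_sub, map_sub,
      kill_X_mem _ (by simp), kill_X_mem _ (by simp)]
    simp
  generalize (Polynomial.X * Polynomial.C (MvPolynomial.X a - MvPolynomial.X b) +
          Polynomial.C (MvPolynomial.X b) : Polynomial (MvPolynomial (Fin r) k)) = l at *
  rw [Ideal.span_insert, Ideal.sup_mul, Submodule.mem_sup] at h ⊢
  obtain ⟨_, hu, _, hv, he⟩ := h
  obtain ⟨u, hu, rfl⟩ := Ideal.mem_span_singleton_mul.1 hu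
  obtain ⟨v, hvQ, rfl⟩ := Ideal.mem_span_singleton_mul.1 hv
  have he2 := congrArg (kill {z}) he
  rw [map_add, map_mul, map_mul, map_mul, kill_base, kill_X_mem _ (by simp), hl1, zero_mul,
    zero_add] at he2
  -- `kill {z} v` is still in the ideal
  have hv2 : kill {z} v ∈ idl k T := by
    have : idl k T ≤ (idl k T).comap (kill {z}) := by
      refine Ideal.span_le.2 ?_
      rintro _ ⟨j, hj, rfl⟩
      have hjz : j ∉ ({z} : Set (Fin r)) := by
        rintro rfl
        exact hzT hj
      change kill {z} _ ∈ idl k T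
      rw [kill_X_not_mem _ hjz]
      exact Ideal.subset_span ⟨j, hj, rfl⟩
    exact this hvQ
  have hnd : ¬ l ∣ Polynomial.mapRingHom (MvPolynomial.C : k →+* MvPolynomial (Fin r) k) p := by
    rintro ⟨c, hc⟩
    have := congrArg (kill {a, b}) hc
    rw [kill_base, map_mul, hl2, zero_mul] at this
    exact base_ne_zero hp this
  obtain ⟨g, hg⟩ := (hl.dvd_or_dvd ⟨_, he2.symm⟩).resolve_left hnd
  have hgQ : g ∈ idl k T := by
    apply idl_base T hp
    have : kill {z} v = Polynomial.mapRingHom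
        (MvPolynomial.C : k →+* MvPolynomial (Fin r) k) p * g := by
      apply mul_left_cancel₀ hl.ne_zero
      rw [he2, hg]
      ring
    rwa [← this]
  have hs := sub_kill_mem {z} f
  rw [idl, Set.image_singleton, Ideal.mem_span_singleton] at hs
  obtain ⟨w, hw⟩ := hs
  have hwQ : w ∈ idl k T := by
    have h1 : Polynomial.C (MvPolynomial.X z : MvPolynomial (Fin r) k) * w ∈ idl k T := by
      rw [← hw, hg]
      exact Ideal.sub_mem _ hfQ (Ideal.mul_mem_left _ _ hgQ)
    rw [mem_idl_iff] at h1 ⊢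
    rw [map_mul, kill_X_not_mem _ hzT] at h1
    refine (mul_eq_zero.1 h1).resolve_left ?_
    simp
  refine ⟨_, Ideal.mem_span_singleton_mul.2 ⟨w, hwQ, rfl⟩, _,
    Ideal.mem_span_singleton_mul.2 ⟨g, hgQ, rfl⟩, ?_⟩
  rw [← hw, ← hg]
  ring

end SundialAux



/-- Let `S = k[x_1,…,x_r]` and `S[λ] = S[X]`, and for `4 + i ≤ r` let
`J_λ = (x_1, λ(x_2-x_3)+x_3)·(x_3,…,x_{i+4}) ⊆ S[λ]`.  Then `S[λ]/J_λ` is a flat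
`k[λ]`-module, where `k[λ]` acts through the canonical map `k[λ] → S[λ] → S[λ]/J_λ`. -/
theorem quotient_by_sundial_family_flat (k : Type*) [Field k] (r i : ℕ)
    (hr : 4 ≤ r) (hi : 4 + i ≤ r)
    (Jlam : Ideal (Polynomial (MvPolynomial (Fin r) k)))
    (hJ : Jlam =
      Ideal.span {Polynomial.C (MvPolynomial.X (⟨0, by omega⟩ : Fin r) :
          MvPolynomial (Fin r) k),
        Polynomial.X * Polynomial.C (MvPolynomial.X ⟨1, by omega⟩ - MvPolynomial.X ⟨2, by omega⟩) +
          Polynomial.C (MvPolynomial.X ⟨2, by omega⟩)} *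
      Ideal.span ((fun j => Polynomial.C (MvPolynomial.X j :
          MvPolynomial (Fin r) k)) '' {j : Fin r | 2 ≤ (j : ℕ) ∧ (j : ℕ) ≤ i + 3})) :
    @Module.Flat (Polynomial k) (Polynomial (MvPolynomial (Fin r) k) ⧸ Jlam) _ _
      (Module.compHom _ ((Ideal.Quotient.mk Jlam).comp
        (Polynomial.mapRingHom (MvPolynomial.C : k →+* MvPolynomial (Fin r) k)))) := by

  letI : Module (Polynomial k) (Polynomial (MvPolynomial (Fin r) k) ⧸ Jlam) :=
    (Module.compHom _ ((Ideal.Quotient.mk Jlam).comp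
        (Polynomial.mapRingHom (MvPolynomial.C : k →+* MvPolynomial (Fin r) k))))
  rw [IsDedekindDomain.flat_iff_torsion_eq_bot, eq_bot_iff]
  rintro m ⟨⟨p, hp⟩, hm⟩
  obtain ⟨f, rfl⟩ := Ideal.Quotient.mk_surjective m
  have hm2 : Ideal.Quotient.mk Jlam
      (Polynomial.mapRingHom (MvPolynomial.C : k →+* MvPolynomial (Fin r) k) p * f) = 0 := by
    rw [map_mul]
    exact hm
  rw [Ideal.Quotient.eq_zero_iff_mem, hJ] at hm2
  rw [Submodule.mem_bot, Ideal.Quotient.eq_zero_iff_mem, hJ]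
  refine SundialAux.key _ _ _ _ ?_ ?_ ?_ ?_ (nonZeroDivisors.ne_zero hp) hm2 <;> simp
end

section
/- Let J_1, …, J_ℓ be ideals of S generated by linear forms, h a linear form regular on each S/J_i, C the cokernel of the natural map S/(∩_i J_i) → ∏_i S/J_i. Then (∩_i (J_i + (h)))/(∩_i J_i + (h)) is isomorphic to Tor_1^S(C, S/(h)). -/
open MvPolynomial CategoryTheory

universe u

variable (k : Type u) [Field k] (r ℓ : ℕ)

/-- The natural map `S/(∩_i J_i) →ₗ ∏_i S/J_i`, `a mod ∩J_i ↦ (a mod J_i)_i`. -/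
noncomputable def diagonalMap (J : Fin ℓ → Ideal (MvPolynomial (Fin r) k)) :
    (MvPolynomial (Fin r) k ⧸ (⨅ j, J j : Ideal (MvPolynomial (Fin r) k))) →ₗ[MvPolynomial (Fin r) k]
      ((i : Fin ℓ) → MvPolynomial (Fin r) k ⧸ J i) :=
  LinearMap.pi fun i =>
    Submodule.mapQ (⨅ j, J j : Ideal (MvPolynomial (Fin r) k)) (J i) LinearMap.id
      (by simpa using iInf_le J i)

/-- The cokernel `C` of the natural map `S/(∩_i J_i) → ∏_i S/J_i`. -/
noncomputable def cokernelC (J : Fin ℓ → Ideal (MvPolynomial (Fin r) k)) : Type u :=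
  ((i : Fin ℓ) → MvPolynomial (Fin r) k ⧸ J i) ⧸ LinearMap.range (diagonalMap k r ℓ J)

noncomputable instance (J : Fin ℓ → Ideal (MvPolynomial (Fin r) k)) :
    AddCommGroup (cokernelC k r ℓ J) :=
  inferInstanceAs (AddCommGroup
    (((i : Fin ℓ) → MvPolynomial (Fin r) k ⧸ J i) ⧸ LinearMap.range (diagonalMap k r ℓ J)))

noncomputable instance (J : Fin ℓ → Ideal (MvPolynomial (Fin r) k)) :
    Module (MvPolynomial (Fin r) k) (cokernelC k r ℓ J) :=
  inferInstanceAs (Module (MvPolynomial (Fin r) k)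
    (((i : Fin ℓ) → MvPolynomial (Fin r) k ⧸ J i) ⧸ LinearMap.range (diagonalMap k r ℓ J)))


theorem rel_down_one_zero : (ComplexShape.down ℕ).Rel 1 0 := rfl

open Limits HomologicalComplex in
noncomputable def twoTermResolution {C : Type*} [Category* C] [Abelian C]
    (S : ShortComplex C) (hS : S.ShortExact) [Projective S.X₁] [Projective S.X₂] :
    ProjectiveResolution S.X₃ where
  complex := double S.f (c := ComplexShape.down ℕ) (i₀ := 1) (i₁ := 0) rel_down_one_zero
  projective n := by
    obtain _ | _ | n := n
    · exact Projective.of_iso (doubleXIso₁ S.f (c := ComplexShape.down ℕ) (i₀ := 1) (i₁ := 0) rel_down_one_zero (by simp)).symm inferInstance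
    · exact Projective.of_iso (doubleXIso₀ S.f (c := ComplexShape.down ℕ) (i₀ := 1) (i₁ := 0) rel_down_one_zero).symm inferInstance
    · exact (isZero_double_X S.f rel_down_one_zero _ (by simp) (by simp)).projective
  π := (ChainComplex.toSingle₀Equiv _ _).symm
    ⟨(doubleXIso₁ S.f (c := ComplexShape.down ℕ) (i₀ := 1) (i₁ := 0) rel_down_one_zero (by simp)).hom ≫ S.g, by
      rw [double_d _ rel_down_one_zero (by simp)]; simp⟩
  quasiIso := ⟨fun n => by
    have := hS.mono_f
    have := hS.epi_g
    obtain _ | _ | n := n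
    · rw [ChainComplex.quasiIsoAt₀_iff, ShortComplex.quasiIso_iff_of_zeros']
      · refine (ShortComplex.exact_and_epi_g_iff_of_iso ?_).2 ⟨hS.exact, hS.epi_g⟩
        refine ShortComplex.isoMk (doubleXIso₀ S.f rel_down_one_zero)
          (doubleXIso₁ S.f rel_down_one_zero (by simp)) (Iso.refl _) ?_ ?_
        · have h1 : (doubleXIso₀ S.f rel_down_one_zero).hom ≫ S.f =
              (double S.f rel_down_one_zero).d 1 0 ≫
                (doubleXIso₁ S.f rel_down_one_zero (by simp)).hom := by
            rw [double_d _ rel_down_one_zero (by simp)]; simp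
          exact h1
        · have h2 : (doubleXIso₁ S.f rel_down_one_zero (by simp)).hom ≫ S.g =
              ((doubleXIso₁ S.f rel_down_one_zero (by simp)).hom ≫ S.g) ≫ 𝟙 S.X₃ := by simp
          have h3 := ChainComplex.toSingle₀Equiv_symm_apply_f_zero
            (C := double S.f rel_down_one_zero) (X := S.X₃)
            ((doubleXIso₁ S.f rel_down_one_zero (by simp)).hom ≫ S.g) (by
              rw [double_d _ rel_down_one_zero (by simp)]; simp)
          exact h2.trans (congrArg (· ≫ 𝟙 S.X₃) h3.symm)
      · exact double_d_eq_zero₀ S.f rel_down_one_zero _ _ (by simp)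
      all_goals rfl
    · rw [quasiIsoAt_iff_exactAt']
      · rw [HomologicalComplex.exactAt_iff' _ 2 1 0 (by simp) (by simp)]
        rw [ShortComplex.exact_iff_mono]
        · simp only [HomologicalComplex.sc', HomologicalComplex.shortComplexFunctor']
          rw [double_d _ rel_down_one_zero (by simp)]
          infer_instance
        · exact (isZero_double_X S.f rel_down_one_zero _ (by simp) (by simp)).eq_of_src _ _
      · apply ChainComplex.exactAt_succ_single_obj
    · rw [quasiIsoAt_iff_exactAt']
      · apply ShortComplex.exact_of_isZero_X₂
        exact (isZero_double_X S.f rel_down_one_zero _ (by simp) (by simp))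
      · apply ChainComplex.exactAt_succ_single_obj⟩

open Limits HomologicalComplex in
theorem leftDerived_one_iso {C D : Type*} [Category* C] [Abelian C] [HasProjectiveResolutions C]
    [Category* D] [Abelian D]
    (S : ShortComplex C) (hS : S.ShortExact) [Projective S.X₁] [Projective S.X₂]
    (F : C ⥤ D) [F.Additive] :
    Nonempty ((F.leftDerived 1).obj S.X₃ ≅ kernel (F.map S.f)) := by
  let e := (twoTermResolution S hS).isoLeftDerivedObj F 1
  let K := (F.mapHomologicalComplex (ComplexShape.down ℕ)).obj (twoTermResolution S hS).complex
  have hz2 : IsZero (K.X 2) :=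
    F.map_isZero (isZero_double_X S.f rel_down_one_zero 2 (by simp) (by simp))
  have hz : K.d 2 1 = 0 := hz2.eq_of_src _ _
  let e2 := K.isoHomologyπ 2 1 (by simp) hz
  let e3 := (K.cyclesIsKernel 1 0 (by simp)).conePointUniqueUpToIso (limit.isLimit (parallelPair (K.d 1 0) 0))
  let e4 : kernel (K.d 1 0) ≅ kernel (F.map S.f) := kernel.mapIso _ _
    (F.mapIso (doubleXIso₀ S.f (c := ComplexShape.down ℕ) (i₀ := 1) (i₁ := 0) rel_down_one_zero))
    (F.mapIso (doubleXIso₁ S.f (c := ComplexShape.down ℕ) (i₀ := 1) (i₁ := 0) rel_down_one_zero (by simp))) (by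
      have h1 : F.map ((double S.f rel_down_one_zero).d 1 0) ≫
            F.map (doubleXIso₁ S.f rel_down_one_zero (by simp)).hom =
          F.map (doubleXIso₀ S.f rel_down_one_zero).hom ≫ F.map S.f := by
        rw [← F.map_comp, ← F.map_comp, double_d _ rel_down_one_zero (by simp)]
        congr 1
        simp
      exact h1)
  exact ⟨e ≪≫ e2.symm ≪≫ e3 ≪≫ e4⟩

open Limits MonoidalCategory in
theorem tor_one_equiv {R : Type u} [CommRing R] (M : Type u) [AddCommGroup M] [Module R M]
    (h : R) (hh : ∀ x, h * x = 0 → x = 0) :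
    Nonempty (((Tor (ModuleCat.{u} R) 1).obj (ModuleCat.of R M)).obj
        (ModuleCat.of R (R ⧸ Ideal.span {h})) ≃ₗ[R] LinearMap.ker (LinearMap.lsmul R M h)) := by
  let S : ShortComplex (ModuleCat.{u} R) :=
    { X₁ := 𝟙_ _
      X₂ := 𝟙_ _
      X₃ := ModuleCat.of R (R ⧸ Ideal.span {h})
      f := h • 𝟙 _
      g := ModuleCat.ofHom (Submodule.mkQ (Ideal.span {h}))
      zero := by
        ext
        change Submodule.mkQ (Ideal.span {h}) (h • (1:R)) = 0
        simp }
  have hS : S.ShortExact := by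
    apply ModuleCat.shortComplex_shortExact
    · intro x
      change Submodule.mkQ (Ideal.span {h}) (x:R) = 0 ↔ ∃ y : R, h * y = x
      rw [Submodule.mkQ_apply, Submodule.Quotient.mk_eq_zero, Ideal.mem_span_singleton, dvd_def]
      simp only [eq_comm]
    · intro x y hxy
      change h * (x:R) = h * (y:R) at hxy
      exact sub_eq_zero.mp (hh _ (by rw [mul_sub, hxy, sub_self]))
    · exact Submodule.mkQ_surjective _
  have hP : Projective (𝟙_ (ModuleCat.{u} R)) :=
    (IsProjective.iff_projective (P := R) (R := R)).1 inferInstance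
  have : Projective S.X₁ := hP
  have : Projective S.X₂ := hP
  obtain ⟨e⟩ := leftDerived_one_iso S hS ((tensoringLeft (ModuleCat.{u} R)).obj (ModuleCat.of R M))
  let e2 : kernel (((tensoringLeft (ModuleCat.{u} R)).obj (ModuleCat.of R M)).map S.f) ≅
      kernel (ModuleCat.ofHom (LinearMap.lsmul R M h)) :=
    kernel.mapIso _ _ (ρ_ (ModuleCat.of R M)) (ρ_ (ModuleCat.of R M)) (by
      have : ModuleCat.ofHom (LinearMap.lsmul R M h) = h • 𝟙 (ModuleCat.of R M) := by
        ext; rfl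
      rw [this]
      change (ModuleCat.of R M ◁ (h • 𝟙 (𝟙_ (ModuleCat.{u} R)))) ≫ _ = _
      rw [MonoidalLinear.whiskerLeft_smul]
      simp)
  exact ⟨(e ≪≫ e2 ≪≫ ModuleCat.kernelIsoKer _).toLinearEquiv⟩

theorem quot_equiv_ker_aux {R M N : Type*} [CommRing R] [AddCommGroup M] [Module R M]
    [AddCommGroup N] [Module R N] (δ : R →ₗ[R] M) (q : M →ₗ[R] N) (h : R)
    (hqs : Function.Surjective q) (hq : ∀ m, q m = 0 ↔ ∃ b, δ b = m)
    (hinj : ∀ m : M, h • m = 0 → m = 0) (A B : Ideal R)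
    (memA : ∀ a, a ∈ A ↔ ∃ m : M, h • m = δ a)
    (memB : ∀ a, a ∈ B ↔ ∃ b, δ (a - h * b) = 0) :
    Nonempty ((↥A ⧸ Submodule.comap A.subtype B) ≃ₗ[R]
      LinearMap.ker (LinearMap.lsmul R N h)) := by
  let P : Submodule R (M × R) :=
    LinearMap.ker (LinearMap.coprod (LinearMap.lsmul R M h) (-δ))
  have hP : ∀ p : M × R, p ∈ P ↔ h • p.1 = δ p.2 := by
    intro p
    simp only [P, LinearMap.mem_ker, LinearMap.coprod_apply, LinearMap.lsmul_apply,
      LinearMap.neg_apply, ← sub_eq_add_neg, sub_eq_zero]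
  let f₁ : P →ₗ[R] A := LinearMap.codRestrict A (LinearMap.snd R M R ∘ₗ P.subtype)
    (fun p => (memA _).2 ⟨p.1.1, (hP _).1 p.2⟩)
  let g₁ : P →ₗ[R] (↥A ⧸ Submodule.comap A.subtype B) := Submodule.mkQ _ ∘ₗ f₁
  let g₂ : P →ₗ[R] LinearMap.ker (LinearMap.lsmul R N h) :=
    LinearMap.codRestrict _ (q ∘ₗ LinearMap.fst R M R ∘ₗ P.subtype) (fun p => by
      rw [LinearMap.mem_ker, LinearMap.lsmul_apply]
      change h • q p.1.1 = 0
      rw [← map_smul, hq]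
      exact ⟨_, ((hP _).1 p.2).symm⟩)
  have s₁ : Function.Surjective g₁ := by
    refine (Submodule.mkQ_surjective _).comp ?_
    rintro ⟨a, ha⟩
    obtain ⟨m, hm⟩ := (memA a).1 ha
    exact ⟨⟨(m, a), (hP _).2 hm⟩, rfl⟩
  have s₂ : Function.Surjective g₂ := by
    rintro ⟨c, hc⟩
    obtain ⟨m, rfl⟩ := hqs c
    rw [LinearMap.mem_ker, LinearMap.lsmul_apply, ← map_smul, hq] at hc
    obtain ⟨a, ha⟩ := hc
    exact ⟨⟨(m, a), (hP _).2 ha.symm⟩, rfl⟩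
  have hker : LinearMap.ker g₁ = LinearMap.ker g₂ := by
    ext ⟨⟨m, a⟩, hp⟩
    have hp' := (hP _).1 hp
    simp only at hp'
    have h1 : g₁ ⟨(m, a), hp⟩ = 0 ↔ a ∈ B := Submodule.Quotient.mk_eq_zero _
    have h2 : g₂ ⟨(m, a), hp⟩ = 0 ↔ q m = 0 := Subtype.ext_iff
    rw [LinearMap.mem_ker, LinearMap.mem_ker, h1, h2, memB, hq]
    refine exists_congr fun b => ?_
    rw [map_sub, ← hp', ← smul_eq_mul, map_smul, ← smul_sub]
    constructor
    · intro H
      exact (sub_eq_zero.1 (hinj _ H)).symm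
    · intro H
      rw [H, sub_self, smul_zero]
  exact ⟨(g₁.quotKerEquivOfSurjective s₁).symm ≪≫ₗ
    Submodule.quotEquivOfEq _ _ hker ≪≫ₗ g₂.quotKerEquivOfSurjective s₂⟩

theorem quot_equiv_ker (J : Fin ℓ → Ideal (MvPolynomial (Fin r) k))
    (h : MvPolynomial (Fin r) k)
    (hreg : ∀ i, ∀ s, h * s ∈ J i → s ∈ J i)
    (A B : Ideal (MvPolynomial (Fin r) k))
    (hA : A = ⨅ i, (J i ⊔ Ideal.span {h}))
    (hB : B = (⨅ i, J i) ⊔ Ideal.span {h}) :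
    Nonempty ((↥A ⧸ Submodule.comap A.subtype B) ≃ₗ[MvPolynomial (Fin r) k]
      LinearMap.ker (LinearMap.lsmul (MvPolynomial (Fin r) k) (cokernelC k r ℓ J) h)) := by
  let R := MvPolynomial (Fin r) k
  let M := (i : Fin ℓ) → R ⧸ J i
  let δ : R →ₗ[R] M := (diagonalMap k r ℓ J) ∘ₗ Submodule.mkQ _
  have hδ : ∀ a i, δ a i = Submodule.Quotient.mk a := fun a i => rfl
  have hrange : LinearMap.range (diagonalMap k r ℓ J) = LinearMap.range δ := by
    rw [LinearMap.range_comp_of_range_eq_top]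
    exact Submodule.range_mkQ _
  have hδ0 : ∀ a, δ a = 0 ↔ a ∈ ⨅ i, J i := by
    intro a
    simp only [funext_iff, hδ, Submodule.mem_iInf]
    exact forall_congr' fun i => Submodule.Quotient.mk_eq_zero _
  have hinj : ∀ m : M, h • m = 0 → m = 0 := by
    intro m hm
    ext i
    have := congrFun hm i
    obtain ⟨s, hs⟩ := Submodule.Quotient.mk_surjective _ (m i)
    rw [Pi.smul_apply, ← hs, ← Submodule.Quotient.mk_smul] at this
    rw [← hs]
    exact (Submodule.Quotient.mk_eq_zero _).2
      (hreg i s ((Submodule.Quotient.mk_eq_zero _).1 this))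
  have memB : ∀ a, a ∈ B ↔ ∃ b, a - h * b ∈ ⨅ i, J i := by
    intro a
    rw [hB, Submodule.mem_sup]
    constructor
    · rintro ⟨y, hy, z, hz, rfl⟩
      obtain ⟨b, rfl⟩ := Ideal.mem_span_singleton.1 hz
      exact ⟨b, by simpa using hy⟩
    · rintro ⟨b, hb⟩
      exact ⟨_, hb, h * b, Ideal.mem_span_singleton.2 ⟨b, rfl⟩, by ring⟩
  have memA : ∀ a, a ∈ A ↔ ∃ m : M, h • m = δ a := by
    intro a
    rw [hA, Submodule.mem_iInf]
    constructor
    · intro H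
      have : ∀ i, ∃ b, a - h * b ∈ J i := by
        intro i
        obtain ⟨y, hy, z, hz, hyz⟩ := Submodule.mem_sup.1 (H i)
        obtain ⟨b, rfl⟩ := Ideal.mem_span_singleton.1 hz
        exact ⟨b, by rw [← hyz]; simpa using hy⟩
      choose b hb using this
      refine ⟨fun i => Submodule.Quotient.mk (b i), ?_⟩
      ext i
      symm
      rw [hδ, Pi.smul_apply, ← Submodule.Quotient.mk_smul]
      exact (Submodule.Quotient.eq _).2 (hb i)
    · rintro ⟨m, hm⟩ i
      obtain ⟨s, hs⟩ := Submodule.Quotient.mk_surjective _ (m i)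
      have := congrFun hm i
      rw [hδ, Pi.smul_apply, ← hs, ← Submodule.Quotient.mk_smul] at this
      have := (Submodule.Quotient.eq _).1 this.symm
      exact Submodule.mem_sup.2 ⟨_, this, h * s, Ideal.mem_span_singleton.2 ⟨s, rfl⟩, by
        rw [smul_eq_mul]; ring⟩
  let q : M →ₗ[R] cokernelC k r ℓ J := Submodule.mkQ (LinearMap.range (diagonalMap k r ℓ J))
  have hq : ∀ m, q m = 0 ↔ ∃ b, δ b = m := by
    intro m
    refine (Submodule.Quotient.mk_eq_zero _).trans ?_
    rw [hrange]; rfl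
  have hqs : Function.Surjective q := Submodule.mkQ_surjective _
  refine quot_equiv_ker_aux δ q h hqs hq hinj A B memA fun a => ?_
  rw [memB]
  exact exists_congr fun b => (hδ0 _).symm

/-- **The saturation defect as a Tor.** -/
theorem quotient_iso_tor_one
    (G : Fin ℓ → Set (MvPolynomial (Fin r) k))
    (hG : ∀ i, G i ⊆ (MvPolynomial.homogeneousSubmodule (Fin r) k 1 : Set (MvPolynomial (Fin r) k)))
    (J : Fin ℓ → Ideal (MvPolynomial (Fin r) k))
    (hJ : ∀ i, J i = Ideal.span (G i))
    (h : MvPolynomial (Fin r) k)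
    (hh : h ∈ MvPolynomial.homogeneousSubmodule (Fin r) k 1)
    (hreg : ∀ i, ∀ s, h * s ∈ J i → s ∈ J i)
    (A B : Ideal (MvPolynomial (Fin r) k))
    (hA : A = ⨅ i, (J i ⊔ Ideal.span {h}))
    (hB : B = (⨅ i, J i) ⊔ Ideal.span {h}) :
    Nonempty ((↥A ⧸ Submodule.comap A.subtype B) ≃ₗ[MvPolynomial (Fin r) k]
      (((Tor (ModuleCat.{u} (MvPolynomial (Fin r) k)) 1).obj
          (ModuleCat.of (MvPolynomial (Fin r) k) (cokernelC k r ℓ J))).obj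
        (ModuleCat.of (MvPolynomial (Fin r) k)
          (MvPolynomial (Fin r) k ⧸ Ideal.span {h})))) := by
  by_cases h0 : ∀ x, h * x = 0 → x = 0
  · obtain ⟨e⟩ := quot_equiv_ker k r ℓ J h hreg A B hA hB
    obtain ⟨e'⟩ := tor_one_equiv (cokernelC k r ℓ J) h h0
    exact ⟨e ≪≫ₗ e'.symm⟩
  · -- Here `h = 0`, which forces every `J i = ⊤`; both sides vanish.
    have hz : h = 0 := by
      by_contra hne
      exact h0 fun x hx => (mul_eq_zero.1 hx).resolve_left hne
    subst hz
    have hJt : ∀ i, J i = ⊤ := fun i =>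
      (Ideal.eq_top_iff_one _).2 (hreg i 1 (by simp))
    have hBt : B = ⊤ := by rw [hB]; simp [hJt]
    have s1 : Subsingleton (↥A ⧸ Submodule.comap A.subtype B) := by
      rw [Submodule.Quotient.subsingleton_iff, hBt, Submodule.comap_top]
    have : Projective (ModuleCat.of (MvPolynomial (Fin r) k)
        (MvPolynomial (Fin r) k ⧸ Ideal.span {(0 : MvPolynomial (Fin r) k)})) := by
      refine (IsProjective.iff_projective _).1 ?_
      exact Module.Projective.of_equiv
        (Submodule.quotEquivOfEqBot (Ideal.span {(0 : MvPolynomial (Fin r) k)}) (by simp)).symm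
    have s2 := ModuleCat.subsingleton_of_isZero
      (isZero_Tor_succ_of_projective _ (ModuleCat.of (MvPolynomial (Fin r) k) (cokernelC k r ℓ J))
        (ModuleCat.of (MvPolynomial (Fin r) k)
          (MvPolynomial (Fin r) k ⧸ Ideal.span {(0 : MvPolynomial (Fin r) k)})) 0)
    exact ⟨{ (0 : (↥A ⧸ Submodule.comap A.subtype B) →ₗ[MvPolynomial (Fin r) k] _) with
      invFun := fun _ => 0
      left_inv := fun _ => Subsingleton.elim _ _
      right_inv := fun _ => s2.elim _ _ }⟩
end
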